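/- Let a partition of {1,…,n} into clusters [g], g = 1,…,G, be given, let W be the corresponding cluster-dummy matrix with M_W = I − P_W, and let P̃ be a deterministic n×n real matrix with zero diagonal satisfying M_W P̃ M_W = P̃. Let η, ε be random vectors in ℝⁿ with E|η_i ε_j| < ∞ for all i,j, let Ξ = E(η εᵀ), and assume Ξ_{ij} = 0 whenever i and j lie in different clusters. Then E(ηᵀ P̃ ε) = tr(P̃ Ξᵀ) = Σ_{g=1}^G Σ_{i,j ∈ [g], i ≠ j} (M_W Ξᵀ M_W)_{ji} P̃_{ij}; i.e. the many-instrument bias of an estimator whose projection matrix has zero diagonal and is invariant under cluster demeaning is a within-cluster weighted sum of the cluster-demeaned error covariances. -/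

import Mathlib

open Matrix Finset MeasureTheory

/-- The product of two matrices that vanish off the blocks of `C` vanishes off these blocks. -/
theorem Matrix.mul_apply_eq_zero_of_block {m κ R : Type*} [Fintype m] [NonUnitalNonAssocSemiring R]
    {C : m → κ} {A B : Matrix m m R} (hA : ∀ i j, C i ≠ C j → A i j = 0)
    (hB : ∀ i j, C i ≠ C j → B i j = 0) (i j : m) (hij : C i ≠ C j) : (A * B) i j = 0 := by
  rw [Matrix.mul_apply]
  refine Finset.sum_eq_zero fun k _ => ?_
  by_cases hik : C i = C k
  · rw [hB k j (hik ▸ hij), mul_zero]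
  · rw [hA i k hik, zero_mul]

/-- The residual maker of a cluster-dummy matrix vanishes across clusters. -/
theorem Matrix.one_sub_dummy_proj_apply_eq_zero {m κ : Type*} [Fintype m] [DecidableEq m]
    [Fintype κ] [DecidableEq κ] {C : m → κ} {W : Matrix m κ ℝ}
    (hW : ∀ i g, W i g = if C i = g then 1 else 0) (i j : m) (hij : C i ≠ C j) :
    (1 - W * (Wᵀ * W)⁻¹ * Wᵀ : Matrix m m ℝ) i j = 0 := by
  have hgram : Wᵀ * W = Matrix.diagonal fun g => (Wᵀ * W) g g := by
    ext g h
    by_cases hgh : g = h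
    · simp [hgh]
    · rw [Matrix.diagonal_apply_ne _ hgh, Matrix.mul_apply]
      refine Finset.sum_eq_zero fun k _ => ?_
      rw [Matrix.transpose_apply, hW, hW]
      grind
  have hne : i ≠ j := fun h => hij (congrArg C h)
  rw [hgram, Matrix.inv_diagonal, Matrix.sub_apply, Matrix.one_apply_ne hne, Matrix.mul_apply]
  simp [Matrix.mul_diagonal, hW, hij]

/-- The expectation of a bilinear form in two random vectors is the trace of its matrix against
the transposed cross-moment matrix. -/
theorem Matrix.integral_dotProduct_mulVec {Ω m : Type*} [MeasurableSpace Ω] {μ : Measure Ω}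
    [Fintype m] (P : Matrix m m ℝ) {η ε : Ω → m → ℝ}
    (hint : ∀ i j, Integrable (fun ω => η ω i * ε ω j) μ) {Ξ : Matrix m m ℝ}
    (hΞ : ∀ i j, Ξ i j = ∫ ω, η ω i * ε ω j ∂μ) :
    (∫ ω, (η ω) ⬝ᵥ (P *ᵥ (ε ω)) ∂μ) = Matrix.trace (P * Ξᵀ) := by
  have hexpand : ∀ ω, (η ω) ⬝ᵥ (P *ᵥ (ε ω)) = ∑ i, ∑ j, P i j * (η ω i * ε ω j) := fun ω => by
    simp only [dotProduct, Matrix.mulVec, Finset.mul_sum]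
    exact Finset.sum_congr rfl fun i _ => Finset.sum_congr rfl fun j _ => by ring
  have hterm : ∀ i j, Integrable (fun ω => P i j * (η ω i * ε ω j)) μ := fun i j =>
    (hint i j).const_mul _
  simp_rw [hexpand]
  rw [integral_finsetSum _ fun i _ => integrable_finsetSum _ fun j _ => hterm i j]
  simp only [Matrix.trace, Matrix.diag_apply, Matrix.mul_apply, Matrix.transpose_apply]
  refine Finset.sum_congr rfl fun i _ => ?_
  rw [integral_finsetSum _ fun j _ => hterm i j]
  exact Finset.sum_congr rfl fun j _ => by rw [integral_const_mul, hΞ]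

/-- For a zero-diagonal matrix `P̃` invariant under cluster demeaning
(`M_W P̃ M_W = P̃`) and errors with block-diagonal covariance `Ξ = E(ηεᵀ)`,
`E(ηᵀP̃ε) = tr(P̃Ξᵀ) = Σ_g Σ_{i,j∈[g], i≠j} (M_W Ξᵀ M_W)_{ji} P̃_{ij}`. -/
theorem stmt14 {Ω : Type*} [MeasurableSpace Ω] (μ : Measure Ω) [IsProbabilityMeasure μ]
    (n G : ℕ) (C : Fin n → Fin G) (hC : Function.Surjective C)
    (W : Matrix (Fin n) (Fin G) ℝ)
    (hW : ∀ i g, W i g = if C i = g then 1 else 0)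
    (MW : Matrix (Fin n) (Fin n) ℝ) (hMW : MW = 1 - W * (Wᵀ * W)⁻¹ * Wᵀ)
    (Pt : Matrix (Fin n) (Fin n) ℝ)
    (hdiag : ∀ i, Pt i i = 0) (hinvariant : MW * Pt * MW = Pt)
    (η ε : Ω → Fin n → ℝ)
    (hint : ∀ i j, Integrable (fun ω => η ω i * ε ω j) μ)
    (Ξ : Matrix (Fin n) (Fin n) ℝ)
    (hΞ : ∀ i j, Ξ i j = ∫ ω, η ω i * ε ω j ∂μ)
    (hclus : ∀ i j, C i ≠ C j → Ξ i j = 0) :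
    (∫ ω, (η ω) ⬝ᵥ (Pt *ᵥ (ε ω)) ∂μ) = Matrix.trace (Pt * Ξᵀ) ∧
    Matrix.trace (Pt * Ξᵀ)
      = ∑ g, ∑ i ∈ Finset.univ.filter (fun i => C i = g),
          ∑ j ∈ Finset.univ.filter (fun j => C j = g ∧ j ≠ i),
            (MW * Ξᵀ * MW) j i * Pt i j := by
  refine ⟨Matrix.integral_dotProduct_mulVec Pt hint hΞ, ?_⟩
  have hM : ∀ i j, C i ≠ C j → MW i j = 0 := by
    rw [hMW]
    exact Matrix.one_sub_dummy_proj_apply_eq_zero hW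
  have hB : ∀ i j, C i ≠ C j → (MW * Ξᵀ * MW) i j = 0 :=
    Matrix.mul_apply_eq_zero_of_block
      (Matrix.mul_apply_eq_zero_of_block hM fun i j hij => hclus j i hij.symm) hM
  have htrace : Matrix.trace (Pt * Ξᵀ) = Matrix.trace (Pt * (MW * Ξᵀ * MW)) := by
    conv_lhs => rw [← hinvariant]
    rw [← Matrix.mul_assoc, Matrix.trace_mul_comm _ MW]
    simp only [Matrix.mul_assoc]
  rw [htrace, Matrix.trace, ← Finset.sum_fiberwise Finset.univ C]
  refine Finset.sum_congr rfl fun g _ => Finset.sum_congr rfl fun i hi => ?_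
  obtain rfl : C i = g := (Finset.mem_filter.mp hi).2
  rw [Matrix.diag_apply, Matrix.mul_apply, Finset.sum_filter]
  refine Finset.sum_congr rfl fun j _ => ?_
  split_ifs with hj
  · exact mul_comm _ _
  · by_cases hji : j = i
    · rw [hji, hdiag, zero_mul]
    · rw [hB j i fun h => hj ⟨h, hji⟩, mul_zero]
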